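/- arXiv:2411.03161 — 2 statements merged into one kernel-verified Lean document; each statement's English description precedes it below -/
import Mathlib

section
/- Let n ≥ 3 and set T_{n,2} = binom(n+1, 2) = n(n+1)/2. Then the Waring rank of q_n^2 satisfies: (1) if n ∈ {3, 7, 23}, then rk(q_n^2) = T_{n,2}; (2) if n > 23 and n = m^2 − 2 for some odd natural number m, then T_{n,2} ≤ rk(q_n^2) ≤ T_{n,2} + 1; (3) if n = 8, then T_{8,2} + 1 ≤ rk(q_8^2) ≤ T_{8,2} + 9 (i.e., 37 ≤ rk(q_8^2) ≤ 45); (4) in all remaining cases, rk(q_n^2) = T_{n,2} + 1 = (n^2+n+2)/2. -/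
open MvPolynomial

noncomputable def qpoly (n : ℕ) : MvPolynomial (Fin n) ℂ :=
  ∑ i : Fin n, X i ^ 2

noncomputable def linForm {n : ℕ} (a : Fin n → ℂ) : MvPolynomial (Fin n) ℂ :=
  ∑ i : Fin n, C (a i) * X i

noncomputable def dotC {n : ℕ} (a b : Fin n → ℂ) : ℂ :=
  ∑ i : Fin n, a i * b i

noncomputable def diffOp {n : ℕ} (φ f : MvPolynomial (Fin n) ℂ) : MvPolynomial (Fin n) ℂ :=
  ∑ d ∈ φ.support, φ.coeff d •
    ((List.ofFn fun i : Fin n =>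
        ((pderiv i).toLinearMap : MvPolynomial (Fin n) ℂ →ₗ[ℂ] MvPolynomial (Fin n) ℂ) ^ d i).prod f)

noncomputable def lap {n : ℕ} (f : MvPolynomial (Fin n) ℂ) : MvPolynomial (Fin n) ℂ :=
  ∑ i : Fin n, pderiv i (pderiv i f)

noncomputable def waringRank (n d : ℕ) (f : MvPolynomial (Fin n) ℂ) : ℕ :=
  sInf {r : ℕ | ∃ a : Fin r → Fin n → ℂ, f = ∑ k : Fin r, linForm (a k) ^ d}

theorem qpoly_sq_eq_sum_iff {n r : ℕ} (a : Fin r → Fin n → ℂ) :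
    qpoly n ^ 2 = ∑ k, linForm (a k) ^ 4 ↔ ∀ x, ∑ k, (a k ⬝ᵥ x) ^ 4 = (x ⬝ᵥ x) ^ 2 := by
  have key : ∀ x : Fin n → ℂ, eval x (qpoly n ^ 2) = (x ⬝ᵥ x) ^ 2 ∧
      eval x (∑ k, linForm (a k) ^ 4) = ∑ k, (a k ⬝ᵥ x) ^ 4 := fun x => by
    simp [qpoly, linForm, dotProduct, sq]
  refine ⟨fun h x => ?_, fun h => MvPolynomial.funext fun x => ?_⟩
  · rw [← (key x).1, ← (key x).2, h]
  · rw [(key x).1, (key x).2, h]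

/-- A scalar multiple of a quartic decomposition can be rescaled to a decomposition. -/
theorem exists_decomposition {n r : ℕ} {ι : Type*} [Fintype ι] (hr : Fintype.card ι = r)
    (a : ι → Fin n → ℂ) {c : ℂ} (hc : c ≠ 0)
    (h : ∀ x, ∑ k, (a k ⬝ᵥ x) ^ 4 = c * (x ⬝ᵥ x) ^ 2) :
    ∃ a : Fin r → Fin n → ℂ, qpoly n ^ 2 = ∑ k, linForm (a k) ^ 4 := by
  obtain ⟨u, hu⟩ := IsAlgClosed.exists_pow_nat_eq c⁻¹ (n := 4) (by norm_num)
  let e := Fintype.equivFinOfCardEq hr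
  refine ⟨fun k => u • a (e.symm k), (qpoly_sq_eq_sum_iff _).2 fun x => ?_⟩
  rw [← e.sum_comp]
  simp only [Equiv.symm_apply_apply, smul_dotProduct, smul_eq_mul, mul_pow]
  rw [← Finset.mul_sum, h, hu, inv_mul_cancel_left₀ hc]

theorem waringRank_le_of_decomposition {n r d : ℕ} {f : MvPolynomial (Fin n) ℂ}
    (h : ∃ a : Fin r → Fin n → ℂ, f = ∑ k, linForm (a k) ^ d) : waringRank n d f ≤ r :=
  Nat.sInf_le h

theorem le_waringRank {n r s d : ℕ} {f : MvPolynomial (Fin n) ℂ}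
    (h : ∃ a : Fin r → Fin n → ℂ, f = ∑ k, linForm (a k) ^ d)
    (hs : ∀ t, ∀ a : Fin t → Fin n → ℂ, f = ∑ k, linForm (a k) ^ d → s ≤ t) :
    s ≤ waringRank n d f :=
  le_csInf ⟨r, h⟩ fun t ⟨a, ha⟩ => hs t a ha

/-! ### Symmetric constructions -/

theorem two_mul_sum_lt {R ι : Type*} [CommRing R] [Fintype ι] [LinearOrder ι] (f : ι → ι → R)
    (hf : ∀ i j, f i j = f j i) :
    2 * ∑ p : {p : ι × ι // p.1 < p.2}, f p.1.1 p.1.2 = ∑ i, ∑ j, f i j - ∑ i, f i i := by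
  have h1 : ∑ p : {p : ι × ι // p.1 < p.2}, f p.1.1 p.1.2 =
      ∑ i, ∑ j, if i < j then f i j else 0 := by
    rw [← Finset.sum_product', ← Finset.sum_filter]
    exact (Finset.sum_subtype (f := fun p : ι × ι => f p.1 p.2) _ (by simp)).symm
  have h2 : ∑ i, ∑ j, (if i < j then f i j else 0) = ∑ i, ∑ j, if j < i then f i j else 0 := by
    rw [Finset.sum_comm]
    simp only [hf]
  have h3 : ∑ i, f i i = ∑ i, ∑ j, if i = j then f i j else 0 := by simp
  rw [two_mul, h1, eq_sub_iff_add_eq]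
  nth_rewrite 2 [h2]
  rw [h3, ← Finset.sum_add_distrib, ← Finset.sum_add_distrib]
  refine Finset.sum_congr rfl fun i _ => ?_
  rw [← Finset.sum_add_distrib, ← Finset.sum_add_distrib]
  refine Finset.sum_congr rfl fun j _ => ?_
  rcases lt_trichotomy i j with h | h | h
  · simp [h, h.not_gt, h.ne]
  · simp [h]
  · simp [h, h.not_gt, h.ne']

theorem card_lt_pairs (n : ℕ) :
    Fintype.card {p : Fin n × Fin n // p.1 < p.2} + n = (n + 1).choose 2 := by
  have h := two_mul_sum_lt (R := ℤ) (ι := Fin n) (fun _ _ => 1) fun _ _ => rfl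
  simp only [Finset.sum_const, Finset.card_univ, Fintype.card_fin, nsmul_eq_mul, mul_one] at h
  have h2 : (2 * (n + 1).choose 2 : ℤ) = (n + 1) * n := by
    rw [Nat.choose_two_right]
    exact_mod_cast Nat.mul_div_cancel' (Nat.even_mul_pred_self (n + 1)).two_dvd
  zify
  linarith

theorem sum_add_pow_four {ι : Type*} [Fintype ι] (x : ι → ℂ) (y : ℂ) :
    ∑ i, (x i + y) ^ 4 = ∑ i, x i ^ 4 + 4 * y * ∑ i, x i ^ 3 + 6 * y ^ 2 * ∑ i, x i ^ 2
      + 4 * y ^ 3 * ∑ i, x i + Fintype.card ι * y ^ 4 := by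
  have : ∀ i, (x i + y) ^ 4 = x i ^ 4 + 4 * y * x i ^ 3 + 6 * y ^ 2 * x i ^ 2
      + 4 * y ^ 3 * x i + y ^ 4 := fun i => by ring
  simp only [this, Finset.sum_add_distrib, ← Finset.mul_sum, Finset.sum_const, Finset.card_univ,
    nsmul_eq_mul]

/-- The sum of `(x i + x j + t) ^ 4` over pairs in terms of power sums. -/
theorem sum_lt_pow_four {ι : Type*} [Fintype ι] [LinearOrder ι] (x : ι → ℂ) (t : ℂ) :
    ∑ p : {p : ι × ι // p.1 < p.2}, (x p.1.1 + x p.1.2 + t) ^ 4 =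
      (Fintype.card ι - 8) * ∑ i, x i ^ 4
      + 4 * (∑ i, x i ^ 3) * ∑ i, x i + 3 * (∑ i, x i ^ 2) ^ 2
      + 4 * t * ((Fintype.card ι - 4) * ∑ i, x i ^ 3 + 3 * (∑ i, x i ^ 2) * ∑ i, x i)
      + 6 * t ^ 2 * ((Fintype.card ι - 2) * ∑ i, x i ^ 2 + (∑ i, x i) ^ 2)
      + 4 * t ^ 3 * (Fintype.card ι - 1) * ∑ i, x i
      + t ^ 4 * (Fintype.card ι * (Fintype.card ι - 1) / 2) := by
  have h := two_mul_sum_lt (fun i j => (x i + x j + t) ^ 4) fun i j => by ring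
  generalize ∑ p : {p : ι × ι // p.1 < p.2}, (x p.1.1 + x p.1.2 + t) ^ 4 = S at h ⊢
  have e1 : ∀ i, ∑ j, (x i + x j + t) ^ 4 = ∑ j, (x j + (x i + t)) ^ 4 := fun i =>
    Finset.sum_congr rfl fun j _ => by ring
  have e2 : ∀ i, (x i + x i + t) ^ 4 = 16 * x i ^ 4 + 32 * t * x i ^ 3 + 24 * t ^ 2 * x i ^ 2
      + 8 * t ^ 3 * x i + t ^ 4 := fun i => by ring
  have e3 : ∀ i, (x i + t) ^ 3 = x i ^ 3 + 3 * t * x i ^ 2 + 3 * t ^ 2 * x i + t ^ 3 :=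
    fun i => by ring
  have e4 : ∀ i, (x i + t) ^ 2 = x i ^ 2 + 2 * t * x i + t ^ 2 := fun i => by ring
  simp only [e1, e2, sum_add_pow_four] at h
  simp only [Finset.sum_add_distrib, ← Finset.mul_sum, ← Finset.sum_mul, sum_add_pow_four, e3, e4,
    Finset.sum_const, Finset.card_univ, nsmul_eq_mul] at h
  linear_combination h / 2

theorem exists_root_quadratic {a : ℂ} (ha : a ≠ 0) (b c : ℂ) : ∃ x, a * (x * x) + b * x + c = 0 := by
  obtain ⟨s, hs⟩ := IsAlgClosed.exists_pow_nat_eq (discrim a b c) (n := 2) (by norm_num)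
  exact exists_quadratic_eq_zero ha ⟨s, by rw [← hs, sq]⟩

theorem exists_decomposition_succ {n : ℕ} (hn : n ≠ 0) (hn8 : n ≠ 8) :
    ∃ a : Fin ((n + 1).choose 2 + 1) → Fin n → ℂ, qpoly n ^ 2 = ∑ k, linForm (a k) ^ 4 := by
  have hn0 : (n : ℂ) ≠ 0 := by exact_mod_cast hn
  have hn8' : (8 - n : ℂ) ≠ 0 := by
    rw [sub_ne_zero]; exact_mod_cast hn8.symm
  obtain ⟨a, ha⟩ := IsAlgClosed.exists_pow_nat_eq (8 - n : ℂ) (n := 4) (by norm_num)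
  have ha0 : a ≠ 0 := by rintro rfl; simp [← ha] at hn8'
  obtain ⟨d, hd⟩ := exists_root_quadratic (mul_ne_zero two_ne_zero hn0) 8 1
  obtain ⟨b, hb⟩ : ∃ b, a ^ 3 * b = -(1 + d * (n - 4)) :=
    ⟨-(1 + d * (n - 4)) / a ^ 3, by field_simp⟩
  have hb2 : a ^ 2 * b ^ 2 = - (2 * d + (n - 2) * d ^ 2) := by
    apply mul_left_cancel₀ hn8'
    linear_combination (-(a ^ 2 * b ^ 2)) * ha + (a ^ 3 * b - (1 + d * (n - 4))) * hb + hd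
  obtain ⟨e, he⟩ := IsAlgClosed.exists_pow_nat_eq
    (-(6 * d ^ 2 + 4 * d ^ 3 * (n - 1) + d ^ 4 * (n * (n - 1) / 2) + 4 * a * b ^ 3 + n * b ^ 4))
    (n := 4) (by norm_num)
  let v : Option ({p : Fin n × Fin n // p.1 < p.2} ⊕ Fin n) → Fin n → ℂ := fun k => match k with
    | none => e • 1
    | some (.inl p) => Pi.single p.1.1 1 + Pi.single p.1.2 1 + d • 1
    | some (.inr i) => a • Pi.single i 1 + b • 1
  refine exists_decomposition (by simp [card_lt_pairs]) v (c := 3) (by norm_num) fun x => ?_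
  rw [Fintype.sum_option, Fintype.sum_sum_type]
  have h4 : ∀ i, (a * x i + b * ∑ j, x j) ^ 4 = a ^ 4 * x i ^ 4
      + 4 * a ^ 3 * b * (∑ j, x j) * x i ^ 3 + 6 * a ^ 2 * b ^ 2 * (∑ j, x j) ^ 2 * x i ^ 2
      + 4 * a * b ^ 3 * (∑ j, x j) ^ 3 * x i + b ^ 4 * (∑ j, x j) ^ 4 := fun i => by ring
  simp only [v, add_dotProduct, smul_dotProduct, single_one_dotProduct, one_dotProduct, smul_eq_mul]
  rw [sum_lt_pow_four]
  simp only [h4, Finset.sum_add_distrib, ← Finset.mul_sum, Fintype.card_fin, dotProduct, ← sq,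
    Finset.sum_const, Finset.card_univ, nsmul_eq_mul]
  linear_combination (∑ i, x i ^ 4) * ha + 4 * (∑ i, x i) * (∑ i, x i ^ 3) * hb
    + 6 * (∑ i, x i) ^ 2 * (∑ i, x i ^ 2) * hb2 + (∑ i, x i) ^ 4 * he

/-- Simplex coordinates: `n + 1` linear forms with sum zero and sum of squares `q_n`. -/
theorem exists_simplex {n : ℕ} (hn : n ≠ 0) : ∃ y : Fin (n + 1) → Fin n → ℂ,
    ∀ x, ∑ i, y i ⬝ᵥ x = 0 ∧ ∑ i, (y i ⬝ᵥ x) ^ 2 = x ⬝ᵥ x := by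
  have hn0 : (n + n ^ 2 : ℂ) ≠ 0 := by
    have : n + n ^ 2 ≠ 0 := by positivity
    exact_mod_cast this
  obtain ⟨α, hα⟩ := exists_root_quadratic hn0 (2 * (n + 1)) 1
  refine ⟨Fin.snoc (α := fun _ => Fin n → ℂ) (fun i => Pi.single i 1 + α • 1)
    (-(1 + n * α) • 1), fun x => ?_⟩
  simp only [Fin.sum_univ_castSucc, Fin.snoc_castSucc, Fin.snoc_last, add_dotProduct,
    smul_dotProduct, single_one_dotProduct, one_dotProduct, smul_eq_mul]
  constructor
  · simp [Finset.sum_add_distrib]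
    ring
  · have e4 : ∀ i, (x i + α * ∑ i, x i) ^ 2 = x i ^ 2 + 2 * (α * ∑ i, x i) * x i
      + (α * ∑ i, x i) ^ 2 := fun i => by ring
    simp only [e4, Finset.sum_add_distrib, ← Finset.mul_sum, Finset.sum_const, Finset.card_univ,
      nsmul_eq_mul, dotProduct, Fintype.card_fin, ← sq]
    linear_combination (∑ i, x i) ^ 2 * hα

theorem exists_decomposition_seven :
    ∃ a : Fin ((7 + 1).choose 2) → Fin 7 → ℂ, qpoly 7 ^ 2 = ∑ k, linForm (a k) ^ 4 := by
  obtain ⟨y, hy⟩ := exists_simplex (n := 7) (by norm_num)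
  have hcard := card_lt_pairs 8
  refine exists_decomposition (ι := {p : Fin 8 × Fin 8 // p.1 < p.2}) ?_
    (fun p => y p.1.1 + y p.1.2) (c := 3) (by norm_num) fun x => ?_
  · norm_num [Nat.choose] at hcard ⊢
    omega
  have h := sum_lt_pow_four (fun i => y i ⬝ᵥ x) 0
  simp only [add_dotProduct]
  simp only [add_zero, (hy x).1, (hy x).2, Fintype.card_fin] at h
  rw [h]; norm_num

theorem exists_decomposition_eight :
    ∃ a : Fin ((8 + 1).choose 2 + 9) → Fin 8 → ℂ, qpoly 8 ^ 2 = ∑ k, linForm (a k) ^ 4 := by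
  obtain ⟨y, hy⟩ := exists_simplex (n := 8) (by norm_num)
  obtain ⟨u, hu⟩ := IsAlgClosed.exists_pow_nat_eq (-1 : ℂ) (n := 4) (by norm_num)
  have hcard := card_lt_pairs 9
  refine exists_decomposition (ι := {p : Fin 9 × Fin 9 // p.1 < p.2} ⊕ Fin 9) ?_
    (Sum.elim (fun p => y p.1.1 + y p.1.2) fun i => u • y i) (c := 3) (by norm_num) fun x => ?_
  · rw [Fintype.card_sum, Fintype.card_fin, hcard]
    rfl
  have h := sum_lt_pow_four (fun i => y i ⬝ᵥ x) 0
  simp only [Fintype.sum_sum_type, Sum.elim_inl, Sum.elim_inr, add_dotProduct, smul_dotProduct,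
    smul_eq_mul, mul_pow, hu]
  simp only [add_zero, (hy x).1, (hy x).2, Fintype.card_fin] at h
  rw [h, ← Finset.mul_sum]
  push_cast
  ring

theorem exists_decomposition_three :
    ∃ a : Fin ((3 + 1).choose 2) → Fin 3 → ℂ, qpoly 3 ^ 2 = ∑ k, linForm (a k) ^ 4 := by
  obtain ⟨φ, hφ⟩ := exists_root_quadratic (one_ne_zero (α := ℂ)) (-1) (-1)
  have hc : 6 * φ ^ 2 ≠ 0 := by
    have : φ ≠ 0 := by rintro rfl; norm_num at hφ
    exact mul_ne_zero (by norm_num) (pow_ne_zero _ this)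
  refine exists_decomposition (ι := Fin 6) rfl
    ![![φ, 1, 0], ![φ, -1, 0], ![0, φ, 1], ![0, φ, -1], ![1, 0, φ], ![-1, 0, φ]] hc fun x => ?_
  simp [Fin.sum_univ_succ, dotProduct]
  linear_combination 2 * (φ ^ 2 + φ - 1) * (x 0 ^ 4 + x 1 ^ 4 + x 2 ^ 4) * hφ

/-! ### The catalecticant and the lower bound -/

theorem three_mul_sum_of_decomposition {n r : ℕ} {a : Fin r → Fin n → ℂ}
    (h : qpoly n ^ 2 = ∑ k, linForm (a k) ^ 4) (i j p q : Fin n) :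
    3 * ∑ k, a k i * a k j * (a k p * a k q) =
      (if i = j then 1 else 0) * (if p = q then 1 else 0) +
      (if i = p then 1 else 0) * (if j = q then 1 else 0) +
      (if i = q then 1 else 0) * (if j = p then 1 else 0) := by
  have hl : ∀ k i, pderiv i (linForm (a k)) = C (a k i) := fun k i => by
    simp [linForm, pderiv_X, Pi.single_apply]
  have hX : ∀ i j : Fin n, pderiv i (X j : MvPolynomial (Fin n) ℂ) =
      C (if i = j then 1 else 0) := fun i j => by
    simp [pderiv_X, Pi.single_apply, eq_comm, apply_ite C]
  have hq : ∀ i, pderiv i (qpoly n) = C 2 * X i := fun i => by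
    simp [qpoly, pderiv_X, Pi.single_apply, (map_ofNat C 2).symm]
  have hpow : ∀ (k i c) (m : ℕ), pderiv i (C c * linForm (a k) ^ (m + 1)) =
      C ((m + 1) * (c * a k i)) * linForm (a k) ^ m := fun k i c m => by
    rw [pderiv_C_mul, Derivation.leibniz_pow, hl]
    simp
    ring
  have hR : pderiv i (pderiv j (pderiv p (pderiv q (∑ k, linForm (a k) ^ 4)))) =
      C (24 * ∑ k, a k i * a k j * (a k p * a k q)) := by
    have : ∀ k, linForm (a k) ^ 4 = C 1 * linForm (a k) ^ (3 + 1) := fun k => by simp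
    rw [Finset.sum_congr rfl fun k _ => this k]
    simp only [map_sum, hpow, Finset.mul_sum]
    refine Finset.sum_congr rfl fun k _ => ?_
    rw [pow_zero, mul_one]
    congr 1
    push_cast
    ring
  have hL : pderiv i (pderiv j (pderiv p (pderiv q (qpoly n ^ 2)))) =
      C (8 * ((if i = j then 1 else 0) * (if p = q then 1 else 0) +
      (if i = p then 1 else 0) * (if j = q then 1 else 0) +
      (if i = q then 1 else 0) * (if j = p then 1 else 0))) := by
    simp only [sq, Derivation.leibniz, hq, hX, map_add, smul_eq_mul, pderiv_C, mul_zero, add_zero,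
      zero_add, map_mul]
    have h2 : (C 8 : MvPolynomial (Fin n) ℂ) = C 2 * C 2 * C 2 := by
      rw [← C_mul, ← C_mul]
      norm_num
    rw [h2]
    have h3 : (C 2 : MvPolynomial (Fin n) ℂ) = 2 := map_ofNat C 2
    rw [h3]
    ring
  rw [h] at hL
  have := C_injective (Fin n) ℂ (hR.symm.trans hL)
  linear_combination this / 8

/-- Evaluation of a symmetric matrix, as a function on unordered pairs, at the squares of the
vectors `a k`. -/
noncomputable def quadEval {n : ℕ} {ι : Type*} (a : ι → Fin n → ℂ) :
    (Sym2 (Fin n) → ℂ) →ₗ[ℂ] (ι → ℂ) where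
  toFun g k := ∑ i, ∑ j, g s(i, j) * (a k i * a k j)
  map_add' g h := by
    ext k
    simp [add_mul, Finset.sum_add_distrib]
  map_smul' c g := by
    ext k
    simp [Finset.mul_sum, mul_assoc]

theorem quadEval_apply {n : ℕ} {ι : Type*} (a : ι → Fin n → ℂ) (g : Sym2 (Fin n) → ℂ) (k : ι) :
    quadEval a g k = ∑ i, ∑ j, g s(i, j) * (a k i * a k j) := rfl

theorem three_mul_sum_quadEval {n r : ℕ} {a : Fin r → Fin n → ℂ}
    (h : qpoly n ^ 2 = ∑ k, linForm (a k) ^ 4) (g : Sym2 (Fin n) → ℂ) (p q : Fin n) :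
    3 * ∑ k, quadEval a g k * (a k p * a k q) =
      (∑ i, g s(i, i)) * (if p = q then 1 else 0) + 2 * g s(p, q) := by
  have e : ∀ k, quadEval a g k * (a k p * a k q) =
      ∑ i, ∑ j, g s(i, j) * (a k i * a k j * (a k p * a k q)) := fun k => by
    simp only [quadEval_apply, Finset.sum_mul, mul_assoc]
  simp only [e]
  rw [Finset.sum_comm, Finset.mul_sum]
  have e2 : ∀ i, 3 * ∑ k, ∑ j, g s(i, j) * (a k i * a k j * (a k p * a k q)) =
      ∑ j, g s(i, j) * ((if i = j then 1 else 0) * (if p = q then 1 else 0) +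
      (if i = p then 1 else 0) * (if j = q then 1 else 0) +
      (if i = q then 1 else 0) * (if j = p then 1 else 0)) := fun i => by
    rw [Finset.sum_comm, Finset.mul_sum]
    refine Finset.sum_congr rfl fun j _ => ?_
    rw [← three_mul_sum_of_decomposition h, ← Finset.mul_sum]
    ring
  simp only [e2, mul_add, Finset.sum_add_distrib]
  simp [Sym2.eq_swap (a := q)]
  ring

theorem quadEval_injective {n r : ℕ} {a : Fin r → Fin n → ℂ}
    (h : qpoly n ^ 2 = ∑ k, linForm (a k) ^ 4) : Function.Injective (quadEval a) := by
  rw [injective_iff_map_eq_zero]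
  intro g hg
  have h0 : ∀ p q, (∑ i, g s(i, i)) * (if p = q then 1 else 0) + 2 * g s(p, q) = 0 := fun p q => by
    rw [← three_mul_sum_quadEval h, hg]
    simp
  have htr : ∑ i, g s(i, i) = 0 := by
    have h1 : ∑ p, ((∑ i, g s(i, i)) * (if p = p then 1 else 0) + 2 * g s(p, p)) = 0 :=
      Finset.sum_eq_zero fun p _ => h0 p p
    simp only [if_true, mul_one, Finset.sum_add_distrib, Finset.sum_const, Finset.card_univ,
      Fintype.card_fin, nsmul_eq_mul, ← Finset.mul_sum] at h1
    have h2 : (n + 2 : ℂ) ≠ 0 := by exact_mod_cast (by omega : n + 2 ≠ 0)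
    exact (mul_eq_zero.1 (by linear_combination h1)).resolve_left h2
  ext z
  induction z with
  | h p q => simpa [htr] using h0 p q

theorem choose_le_of_decomposition {n r : ℕ} {a : Fin r → Fin n → ℂ}
    (h : qpoly n ^ 2 = ∑ k, linForm (a k) ^ 4) : (n + 1).choose 2 ≤ r := by
  simpa [Sym2.card] using LinearMap.finrank_le_finrank_of_injective (quadEval_injective h)

theorem equiangular_of_decomposition {n : ℕ} {a : Fin ((n + 1).choose 2) → Fin n → ℂ}
    (h : qpoly n ^ 2 = ∑ k, linForm (a k) ^ 4) (j k : Fin ((n + 1).choose 2)) :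
    3 * (n + 2) * (a j ⬝ᵥ a k) ^ 2 =
      3 * (a j ⬝ᵥ a j) * (a k ⬝ᵥ a k) + if j = k then 2 * (n + 2 : ℂ) else 0 := by
  obtain ⟨g, hg⟩ := (LinearMap.injective_iff_surjective_of_finrank_eq_finrank
    (by simp [Sym2.card])).1 (quadEval_injective h) (Pi.single k 1)
  have h1 : ∀ p q, 3 * (a k p * a k q) =
      (∑ i, g s(i, i)) * (if p = q then 1 else 0) + 2 * g s(p, q) := fun p q => by
    rw [← three_mul_sum_quadEval h, hg]
    simp [Pi.single_apply]
  have htr : 3 * (a k ⬝ᵥ a k) = (n + 2) * ∑ i, g s(i, i) := by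
    rw [dotProduct, Finset.mul_sum, Finset.sum_congr rfl fun p _ => h1 p p]
    simp [Finset.sum_add_distrib, ← Finset.mul_sum]
    ring
  have h2 : 3 * (a j ⬝ᵥ a k) ^ 2 = (∑ i, g s(i, i)) * (a j ⬝ᵥ a j) + 2 * quadEval a g j := by
    have : 3 * (a j ⬝ᵥ a k) ^ 2 = ∑ p, ∑ q, 3 * (a k p * a k q) * (a j p * a j q) := by
      rw [dotProduct, sq, Finset.sum_mul_sum, Finset.mul_sum]
      simp only [Finset.mul_sum]
      exact Finset.sum_congr rfl fun p _ => Finset.sum_congr rfl fun q _ => by ring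
    rw [this, quadEval_apply]
    simp only [h1, add_mul, Finset.sum_add_distrib, Finset.mul_sum, dotProduct]
    simp [mul_assoc]
  rw [hg, Pi.single_apply] at h2
  split_ifs at h2 ⊢ with hjk <;> linear_combination (n + 2 : ℂ) * h2 - (a j ⬝ᵥ a j) * htr

theorem sum_dotProduct_self_mul {n r : ℕ} {a : Fin r → Fin n → ℂ}
    (h : qpoly n ^ 2 = ∑ k, linForm (a k) ^ 4) (x y : Fin n → ℂ) :
    3 * ∑ k, (a k ⬝ᵥ a k) * ((x ⬝ᵥ a k) * (a k ⬝ᵥ y)) = (n + 2) * (x ⬝ᵥ y) := by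
  have h1 := three_mul_sum_quadEval h (fun z => if z.IsDiag then 1 else 0)
  have e : ∀ k, quadEval a (fun z => if z.IsDiag then 1 else 0) k = a k ⬝ᵥ a k := fun k => by
    simp [quadEval_apply, dotProduct]
  simp only [e, Sym2.mk_isDiag_iff, if_true, Finset.sum_const, Finset.card_univ, Fintype.card_fin,
    nsmul_eq_mul, mul_one] at h1
  have e3 : ∀ k, (x ⬝ᵥ a k) * (a k ⬝ᵥ y) = ∑ p, ∑ q, x p * y q * (a k p * a k q) := fun k => by
    rw [dotProduct, dotProduct, Finset.sum_mul_sum]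
    exact Finset.sum_congr rfl fun p _ => Finset.sum_congr rfl fun q _ => by ring
  have h2 : 3 * ∑ k, (a k ⬝ᵥ a k) * ((x ⬝ᵥ a k) * (a k ⬝ᵥ y)) =
      ∑ p, ∑ q, x p * y q * (3 * ∑ k, (a k ⬝ᵥ a k) * (a k p * a k q)) := by
    simp only [e3, Finset.mul_sum]
    rw [Finset.sum_comm]
    refine Finset.sum_congr rfl fun p _ => ?_
    rw [Finset.sum_comm]
    exact Finset.sum_congr rfl fun q _ => Finset.sum_congr rfl fun k _ => by ring
  rw [h2]
  simp only [h1]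
  simp only [mul_add, mul_ite, mul_one, mul_zero, Finset.sum_add_distrib, Finset.sum_ite_eq,
    Finset.mem_univ, if_true, dotProduct, Finset.mul_sum]
  rw [← Finset.sum_add_distrib]
  exact Finset.sum_congr rfl fun p _ => by ring

/-! ### Sign matrices of equiangular systems -/

theorem prod_eq_neg_of_zmod_four : ∀ k a b c : ZMod 4, (a = 1 ∨ a = -1) → (b = 1 ∨ b = -1) →
    (c = 1 ∨ c = -1) →
    (2 * k ^ 2 - 1) * (4 * k ^ 2 - 1) - 3 + k * (4 * k ^ 2 - 5) * (a + b + c)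
      - (a * b + b * c + a * c) = 0 → a * b * c = -k := by
  decide

section SignMatrix

variable {N : ℕ} {σ : Fin N → Fin N → ℤ} {τ : ℤ}

/-- The triple count of a symmetric sign matrix with quadratic minimal polynomial. -/
theorem four_dvd_of_sign_matrix (hsymm : ∀ i j, σ i j = σ j i) (hdiag : ∀ i, σ i i = 0)
    (hsign : ∀ i j, i ≠ j → σ i j = 1 ∨ σ i j = -1)
    (hmul : ∀ i j, i ≠ j → ∑ k, σ i k * σ k j = τ * σ i j)
    {i j l : Fin N} (hij : i ≠ j) (hjl : j ≠ l) (hil : i ≠ l) :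
    (4 : ℤ) ∣ N - 3 + τ * (σ i j + σ j l + σ i l)
      - (σ i j * σ j l + σ j l * σ i l + σ i j * σ i l) := by
  let F : Fin N → ℤ := fun k => (σ i k + σ j k) * (σ i k + σ l k)
  have hF : (4 : ℤ) ∣ ∑ k, (F k - (if k = i then F i else 0) - (if k = j then F j else 0)
      - (if k = l then F l else 0)) := by
    refine Finset.dvd_sum fun k _ => ?_
    by_cases hki : k = i
    · simp [hki, hij, hil]
    by_cases hkj : k = j
    · simp [hkj, hij.symm, hjl]
    by_cases hkl : k = l
    · simp [hkl, hil.symm, hjl.symm]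
    simp only [hki, hkj, hkl, if_false, sub_zero, F]
    rcases hsign i k (Ne.symm hki) with h1 | h1 <;> rcases hsign j k (Ne.symm hkj) with h2 | h2 <;>
      rcases hsign l k (Ne.symm hkl) with h3 | h3 <;> rw [h1, h2, h3] <;> norm_num
  have hsq : ∑ k, σ i k * σ i k = N - 1 := by
    have : ∀ k, σ i k * σ i k = 1 - if k = i then 1 else 0 := fun k => by
      by_cases hk : k = i
      · simp [hk, hdiag]
      · rcases hsign i k (Ne.symm hk) with h | h <;> simp [h, hk]
    simp [this]
  have hsum : ∑ k, F k = N - 1 + τ * (σ i j + σ j l + σ i l) := by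
    have : ∀ k, F k = σ i k * σ i k + σ i k * σ k l + σ j k * σ k i + σ j k * σ k l := fun k => by
      simp only [F, hsymm k]
      ring
    simp only [this, Finset.sum_add_distrib, hsq, hmul i l hil, hmul j i hij.symm, hmul j l hjl,
      hsymm j i]
    ring
  have h1 : ∀ i j, i ≠ j → σ i j * σ i j = 1 := fun i j hij => by
    rcases hsign i j hij with h | h <;> simp [h]
  simp only [Finset.sum_sub_distrib, Finset.sum_ite_eq', Finset.mem_univ, if_true, hsum] at hF
  simp only [F, hdiag, hsymm j i, hsymm l i, hsymm l j] at hF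
  convert hF using 1
  linear_combination h1 i j hij + h1 i l hil

theorem exists_odd_sq_of_sign_matrix {n : ℕ} (hn : 3 < n) (hN : N = (n + 1).choose 2)
    (hsymm : ∀ i j, σ i j = σ j i) (hdiag : ∀ i, σ i i = 0)
    (hsign : ∀ i j, i ≠ j → σ i j = 1 ∨ σ i j = -1)
    (hmul : ∀ i j, i ≠ j → ∑ k, σ i k * σ k j = τ * σ i j)
    (hτ : 4 * τ ^ 2 = (n + 2) * (n - 3) ^ 2) : ∃ m : ℕ, Odd m ∧ n = m ^ 2 - 2 := by
  have hN2 : (2 * N : ℤ) = (n + 1) * n := by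
    rw [hN, Nat.choose_two_right]
    exact_mod_cast Nat.mul_div_cancel' (Nat.even_mul_pred_self (n + 1)).two_dvd
  have hn' : (4 : ℤ) ≤ n := by exact_mod_cast hn
  have hn3 : (n - 3 : ℤ) ≠ 0 := by omega
  obtain ⟨m, hm⟩ : (n - 3 : ℤ) ∣ 2 * τ := by
    rw [← Int.pow_dvd_pow_iff two_ne_zero]
    exact ⟨n + 2, by linear_combination hτ⟩
  have hm2 : m ^ 2 = n + 2 := by
    apply mul_right_cancel₀ (pow_ne_zero 2 hn3)
    linear_combination hτ - (2 * τ + (n - 3) * m) * hm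
  rcases Int.even_or_odd m with ⟨k, hk⟩ | hodd
  · exfalso
    have hnk : (n : ℤ) = 4 * k ^ 2 - 2 := by rw [hk] at hm2; linear_combination -hm2
    have hτk : τ = k * (4 * k ^ 2 - 5) := by
      rw [hnk, hk] at hm; linarith
    have hNk : (N : ℤ) = (2 * k ^ 2 - 1) * (4 * k ^ 2 - 1) := by
      rw [hnk] at hN2; linarith
    have hzmod : ∀ i j, i ≠ j → ((σ i j : ZMod 4) = 1 ∨ (σ i j : ZMod 4) = -1) := fun i j hij => by
      rcases hsign i j hij with h | h <;> simp [h]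
    have htriple : ∀ i j l, i ≠ j → j ≠ l → i ≠ l →
        ((σ i j * σ j l * σ i l : ℤ) : ZMod 4) = -k := fun i j l hij hjl hil => by
      have h := four_dvd_of_sign_matrix hsymm hdiag hsign hmul hij hjl hil
      rw [hNk, hτk] at h
      have h' := (ZMod.intCast_zmod_eq_zero_iff_dvd _ 4).2 h
      push_cast at h' ⊢
      exact prod_eq_neg_of_zmod_four k _ _ _ (hzmod _ _ hij) (hzmod _ _ hjl) (hzmod _ _ hil) h'
    have hN3 : 3 ≤ N := by zify; nlinarith
    obtain ⟨i, j, l, hij, hjl, hil⟩ : ∃ i j l : Fin N, i ≠ j ∧ j ≠ l ∧ i ≠ l :=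
      ⟨⟨0, by omega⟩, ⟨1, by omega⟩, ⟨2, by omega⟩, by simp, by simp, by simp⟩
    set ε := σ i j * σ j l * σ i l with hε
    have hprod : ∀ i j l, i ≠ j → j ≠ l → i ≠ l →
        (σ i j * σ j l * σ i l = 1 ∨ σ i j * σ j l * σ i l = -1) := fun i j l hij hjl hil => by
      rcases hsign i j hij with h1 | h1 <;> rcases hsign j l hjl with h2 | h2 <;>
      rcases hsign i l hil with h3 | h3 <;> simp [h1, h2, h3]
    have hconst : ∀ k, k ≠ i → k ≠ j → σ i k * σ k j = ε * σ i j := fun k hki hkj => by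
      have e : σ i k * σ k j * σ i j = ε := by
        have h1 := htriple i j l hij hjl hil
        rw [← htriple i k j hki.symm hkj hij, ← hε] at h1
        rcases hprod i k j hki.symm hkj hij with h2 | h2 <;>
          rcases hprod i j l hij hjl hil with h3 | h3 <;> rw [← hε] at h3 <;>
          rw [h2, h3] at h1 ⊢ <;> revert h1 <;> decide
      rw [← e]
      rcases hsign i j hij with h | h <;> simp [h]
    have hsum : τ * σ i j = (N - 2) * (ε * σ i j) := by
      rw [← hmul i j hij]
      have : ∀ k, σ i k * σ k j = ε * σ i j - (if k = i then ε * σ i j else 0)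
          - (if k = j then ε * σ i j else 0) := fun k => by
        by_cases hki : k = i
        · simp [hki, hdiag, hij]
        by_cases hkj : k = j
        · simp [hkj, hdiag, hij.symm]
        simp [hki, hkj, hconst k hki hkj]
      simp only [this, Finset.sum_sub_distrib, Finset.sum_const, Finset.card_univ,
        Fintype.card_fin, nsmul_eq_mul, Finset.sum_ite_eq', Finset.mem_univ, if_true]
      ring
    have hτN : τ ^ 2 = (N - 2) ^ 2 := by
      have hs : σ i j ≠ 0 := by rcases hsign i j hij with h | h <;> simp [h]
      rw [mul_right_cancel₀ hs (hsum.trans (mul_assoc _ _ _).symm), mul_pow]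
      rcases hprod i j l hij hjl hil with h | h <;> rw [← hε] at h <;> simp [h]
    have hfin : ((n : ℤ) ^ 2 + n - 4) ^ 2 = (n + 2) * (n - 3) ^ 2 := by
      linear_combination hτ - 4 * hτN + (-(2 * N) + 4 - (n ^ 2 + n - 4)) * hN2
    nlinarith [mul_nonneg (sub_nonneg.2 hn') (sub_nonneg.2 hn'), pow_pos (by omega : (0 : ℤ) < n) 3]
  · refine ⟨m.natAbs, Int.natAbs_odd.2 hodd, ?_⟩
    have : m.natAbs ^ 2 = n + 2 := by zify; rw [sq_abs, hm2]
    omega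

end SignMatrix

theorem exists_odd_sq_of_decomposition {n : ℕ} (hn : 3 < n)
    {a : Fin ((n + 1).choose 2) → Fin n → ℂ} (h : qpoly n ^ 2 = ∑ k, linForm (a k) ^ 4) :
    ∃ m : ℕ, Odd m ∧ n = m ^ 2 - 2 := by
  have hn2 : (n + 2 : ℂ) ≠ 0 := by exact_mod_cast (by omega : n + 2 ≠ 0)
  have hself : ∀ k, 3 * (n + 1) * (a k ⬝ᵥ a k) ^ 2 = 2 * (n + 2) := fun k => by
    have := equiangular_of_decomposition h k k
    rw [if_pos rfl] at this
    linear_combination this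
  obtain ⟨μ, hμ⟩ := IsAlgClosed.exists_pow_nat_eq (n + 2 : ℂ) (n := 2) (by norm_num)
  have hself0 : ∀ k, a k ⬝ᵥ a k ≠ 0 := fun k h0 => by
    have := hself k
    rw [h0] at this
    simp [hn2] at this
  choose u hu using fun k => IsAlgClosed.exists_pow_nat_eq (a k ⬝ᵥ a k)⁻¹ (n := 2) (by norm_num)
  have hu1 : ∀ k, u k ^ 2 * (a k ⬝ᵥ a k) = 1 := fun k => by
    rw [hu, inv_mul_cancel₀ (hself0 k)]
  have hu2 : ∀ k, 2 * (n + 2) * u k ^ 2 = 3 * (n + 1) * (a k ⬝ᵥ a k) := fun k => by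
    apply mul_right_cancel₀ (hself0 k)
    linear_combination 2 * (n + 2) * hu1 k - hself k
  set γ : Fin ((n + 1).choose 2) → Fin ((n + 1).choose 2) → ℂ :=
    fun i j => u i * u j * (a i ⬝ᵥ a j) with hγ
  have hγsymm : ∀ i j, γ i j = γ j i := fun i j => by
    simp only [hγ, dotProduct_comm (a i), mul_comm (u i)]
  have hγ1 : ∀ i, γ i i = 1 := fun i => by rw [← hu1 i]; simp only [hγ]; ring
  have hγsq : ∀ i j, i ≠ j → (μ * γ i j) ^ 2 = 1 := fun i j hij => by
    have := equiangular_of_decomposition h i j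
    rw [if_neg hij] at this
    rw [mul_pow, hμ]
    simp only [hγ]
    linear_combination u i ^ 2 * u j ^ 2 / 3 * this + u j ^ 2 * (a j ⬝ᵥ a j) * hu1 i + hu1 j
  have hγmul : ∀ i j, ∑ k, γ i k * γ k j = (n + 1) / 2 * γ i j := fun i j => by
    have h1 := sum_dotProduct_self_mul h (a i) (a j)
    have h2 : (n + 2) * 2 * ∑ k, γ i k * γ k j = (n + 1) * (u i * u j) *
        (3 * ∑ k, (a k ⬝ᵥ a k) * ((a i ⬝ᵥ a k) * (a k ⬝ᵥ a j))) := by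
      simp only [Finset.mul_sum, hγ]
      refine Finset.sum_congr rfl fun k _ => ?_
      linear_combination u i * u j * (a i ⬝ᵥ a k) * (a k ⬝ᵥ a j) * hu2 k
    apply mul_left_cancel₀ hn2
    rw [h1] at h2
    simp only [hγ] at h2 ⊢
    linear_combination h2 / 2
  have hσ : ∀ i j, ∃ s : ℤ, (s : ℂ) = μ * (γ i j - if i = j then 1 else 0) ∧
      (i ≠ j → s = 1 ∨ s = -1) := fun i j => by
    by_cases hij : i = j
    · exact ⟨0, by simp [hij, hγ1], fun h => absurd hij h⟩
    · rcases sq_eq_one_iff.1 (hγsq i j hij) with h | h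
      · exact ⟨1, by simp [hij, h], fun _ => .inl rfl⟩
      · exact ⟨-1, by simp [hij, h], fun _ => .inr rfl⟩
  choose σ hσ hsign using hσ
  have hsymm : ∀ i j, σ i j = σ j i := fun i j => by
    have : (σ i j : ℂ) = σ j i := by rw [hσ, hσ, hγsymm]; simp only [eq_comm]
    exact_mod_cast this
  have hdiag : ∀ i, σ i i = 0 := fun i => by
    have : (σ i i : ℂ) = 0 := by rw [hσ, hγ1]; simp
    exact_mod_cast this
  have hmul : ∀ i j, i ≠ j → ((∑ k, σ i k * σ k j : ℤ) : ℂ) = μ * (n - 3) / 2 * σ i j :=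
      fun i j hij => by
    push_cast
    have e : ∀ k, (σ i k * σ k j : ℂ) = μ ^ 2 * (γ i k * γ k j - (if i = k then γ k j else 0)
        - (if k = j then γ i k else 0)) := fun k => by
      rw [hσ, hσ]
      by_cases hik : i = k
      · subst hik
        simp [hij, hγ1]
      by_cases hkj : k = j
      · subst hkj
        simp [hik, hγ1]
      · simp only [hik, hkj, if_false, sub_zero]
        ring
    rw [Finset.sum_congr rfl fun k _ => e k]
    simp only [← Finset.mul_sum, Finset.sum_sub_distrib, hγmul, Finset.sum_ite_eq,
      Finset.sum_ite_eq', Finset.mem_univ, if_true, hσ, if_neg hij]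
    ring
  obtain ⟨i₀, j₀, hij₀⟩ : ∃ i j : Fin ((n + 1).choose 2), i ≠ j := by
    have : 2 ≤ (n + 1).choose 2 := le_trans (by norm_num [Nat.choose])
      (Nat.choose_le_choose 2 (by omega : 4 ≤ n + 1))
    exact ⟨⟨0, by omega⟩, ⟨1, by omega⟩, by simp⟩
  have hσ0 : (σ i₀ j₀ : ℂ) ^ 2 = 1 := by rcases hsign _ _ hij₀ with h | h <;> simp [h]
  have hτ : (((∑ k, σ i₀ k * σ k j₀) * σ i₀ j₀ : ℤ) : ℂ) = μ * (n - 3) / 2 := by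
    rw [Int.cast_mul, hmul _ _ hij₀]
    linear_combination (μ * (n - 3) / 2) * hσ0
  set τ := (∑ k, σ i₀ k * σ k j₀) * σ i₀ j₀
  refine exists_odd_sq_of_sign_matrix (τ := τ) hn rfl hsymm hdiag hsign (fun i j hij => ?_) ?_
  · have := hmul i j hij
    rw [← hτ] at this
    exact_mod_cast this
  · have : (4 * τ ^ 2 : ℂ) = (n + 2) * (n - 3) ^ 2 := by
      rw [hτ]
      linear_combination (n - 3) ^ 2 * hμ
    exact_mod_cast this

/-! ### Tight systems of equiangular lines -/

/-- A system of `(n + 1).choose 2` equiangular unit vectors gives a quartic decomposition. -/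
theorem sum_pow_four_of_equiangular {n : ℕ} {ι : Type*} [Fintype ι] [DecidableEq ι]
    (hι : Fintype.card ι = (n + 1).choose 2) (b : ι → Fin n → ℂ) {s : ℂ} (hs1 : 1 - s ≠ 0)
    (hs : 1 - s + Fintype.card ι * s ≠ 0)
    (hb : ∀ j k, (b j ⬝ᵥ b k) ^ 2 = (1 - s) * (if j = k then 1 else 0) + s)
    (hb1 : ∀ j, b j ⬝ᵥ b j = 1) (x : Fin n → ℂ) :
    ∑ k, (b k ⬝ᵥ x) ^ 4 = (1 - s + s * (1 - s + Fintype.card ι * s)) * (x ⬝ᵥ x) ^ 2 := by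
  let A : (Fin n → ℂ) → Sym2 (Fin n) → ℂ := fun v z => (z.map v).mul
  have hA : ∀ v w : Fin n → ℂ, ∀ w', (∑ i, ∑ j, A v s(i, j) * (w i * w' j)) =
      (v ⬝ᵥ w) * (v ⬝ᵥ w') := fun v w w' => by
    rw [dotProduct, dotProduct, Finset.sum_mul_sum]
    exact Finset.sum_congr rfl fun p _ => Finset.sum_congr rfl fun q _ => by
      simp [A]
      ring
  have hQ : ∀ v k, quadEval b (A v) k = (v ⬝ᵥ b k) ^ 2 := fun v k => by
    rw [quadEval_apply, hA, sq]
  let I : Sym2 (Fin n) → ℂ := fun z => if z.IsDiag then 1 else 0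
  have hI : ∀ w : Fin n → ℂ, ∑ i, ∑ j, I s(i, j) * (w i * w j) = w ⬝ᵥ w := fun w => by
    simp [I, dotProduct]
  have hQI : ∀ k, quadEval b I k = 1 := fun k => by rw [quadEval_apply, hI, hb1]
  have hinj : Function.Injective (quadEval b) := by
    rw [LinearMap.injective_iff_surjective_of_finrank_eq_finrank (by simp [Sym2.card, hι])]
    intro t
    obtain ⟨c, hc⟩ : ∃ c, c * (1 - s + Fintype.card ι * s) = ∑ l, t l := ⟨_, div_mul_cancel₀ _ hs⟩
    refine ⟨∑ k, ((t k - s * c) / (1 - s)) • A (b k), ?_⟩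
    ext j
    simp only [map_sum, map_smul, Finset.sum_apply, Pi.smul_apply, hQ, hb, smul_eq_mul, mul_add,
      Finset.sum_add_distrib, mul_ite, mul_one, mul_zero, Finset.sum_ite_eq', Finset.mem_univ,
      if_true, ← Finset.sum_mul, ← Finset.sum_div, Finset.sum_sub_distrib, Finset.sum_const,
      Finset.card_univ, nsmul_eq_mul]
    rw [← hc]
    field_simp
    ring
  have hframe : ∑ k, A (b k) = (1 - s + Fintype.card ι * s) • I := by
    apply hinj
    ext j
    simp only [map_sum, map_smul, Finset.sum_apply, Pi.smul_apply, hQ, hb, hQI, smul_eq_mul,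
      Finset.sum_add_distrib, mul_ite, mul_one, mul_zero, Finset.sum_ite_eq', Finset.mem_univ,
      if_true, Finset.sum_const, Finset.card_univ, nsmul_eq_mul]
  have hsum : ∀ y : Fin n → ℂ, ∑ k, (b k ⬝ᵥ y) ^ 2 = (1 - s + Fintype.card ι * s) * (y ⬝ᵥ y) :=
      fun y => by
    have h1 := congrArg (fun g : Sym2 (Fin n) → ℂ => ∑ i, ∑ j, g s(i, j) * (y i * y j)) hframe
    simp only [Finset.sum_apply, Pi.smul_apply, smul_eq_mul, mul_assoc, ← Finset.mul_sum, hI] at h1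
    rw [← h1]
    simp only [sq, ← hA, Finset.sum_mul]
    rw [Finset.sum_comm]
    exact Finset.sum_congr rfl fun i _ => Finset.sum_comm
  have hquad : ∑ k, (b k ⬝ᵥ x) ^ 2 • A (b k) =
      (1 - s) • A x + (s * ((1 - s + Fintype.card ι * s) * (x ⬝ᵥ x))) • I := by
    apply hinj
    ext j
    simp only [map_add, map_sum, map_smul, Finset.sum_apply, Pi.add_apply, Pi.smul_apply, hQ, hb,
      hQI, smul_eq_mul, mul_add, Finset.sum_add_distrib, mul_ite, mul_one, mul_zero,
      Finset.sum_ite_eq', Finset.mem_univ, if_true, ← Finset.sum_mul, hsum, dotProduct_comm (b j)]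
    ring
  have h1 := congrArg (fun g : Sym2 (Fin n) → ℂ => ∑ i, ∑ j, g s(i, j) * (x i * x j)) hquad
  simp only [Finset.sum_apply, Pi.add_apply, Pi.smul_apply, smul_eq_mul, mul_assoc, add_mul,
    Finset.sum_add_distrib, ← Finset.mul_sum, hI, hA] at h1
  have h2 : ∑ k, (b k ⬝ᵥ x) ^ 4 = ∑ i, ∑ j, (∑ k, (b k ⬝ᵥ x) ^ 2 * A (b k) s(i, j)) * (x i * x j) := by
    have e : ∀ k, (b k ⬝ᵥ x) ^ 4 = ∑ i, ∑ j, (b k ⬝ᵥ x) ^ 2 * (A (b k) s(i, j) * (x i * x j)) :=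
      fun k => by
        simp only [← Finset.mul_sum, hA]
        ring
    simp only [e, Finset.sum_mul, mul_assoc]
    rw [Finset.sum_comm]
    exact Finset.sum_congr rfl fun i _ => Finset.sum_comm
  rw [h2, h1]
  ring

/-! ### The 253 blocks of the Steiner system `S(4, 7, 23)` -/

/-- Whether the residue `x` lies in a base block of the Witt design on 23 points. -/
def wittBase (x : ZMod 23) : Bool :=
  [0, 1, 2, 3, 5, 14, 17].contains x.val

/-- The images of the base block under the affine maps with quadratic residue slope. -/
def wittBlock (u : Fin 11 × ZMod 23) (x : ZMod 23) : Bool :=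
  wittBase (2 ^ u.1.val * x + u.2)

theorem wittBase_inter : ∀ (u : Fin 11) (v : ZMod 23), u = 0 ∧ v = 0 ∨
    (∑ x, if wittBase x && wittBase (2 ^ u.val * x + v) then 1 else 0 : ℕ) = 1 ∨
    (∑ x, if wittBase x && wittBase (2 ^ u.val * x + v) then 1 else 0 : ℕ) = 3 := by
  decide +kernel

theorem exists_affine_equiv (i : Fin 11) (c : ZMod 23) :
    ∃ e : ZMod 23 ≃ ZMod 23, ∀ x, e x = 2 ^ i.val * x + c := by
  have h : ∀ i : Fin 11, (2 : ZMod 23) ^ i.val * 2 ^ (-i).val = 1 := by decide +kernel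
  exact ⟨⟨fun x => 2 ^ i.val * x + c, fun y => 2 ^ (-i).val * (y - c),
    fun x => by linear_combination x * h i, fun y => by linear_combination (y - c) * h i⟩,
    fun _ => rfl⟩

theorem card_wittBlock_inter (u v : Fin 11 × ZMod 23) (huv : u ≠ v) :
    (∑ x, if wittBlock u x && wittBlock v x then 1 else 0 : ℕ) = 1 ∨
    (∑ x, if wittBlock u x && wittBlock v x then 1 else 0 : ℕ) = 3 := by
  have hpow : ∀ i j : Fin 11, (2 : ZMod 23) ^ (i - j).val * 2 ^ j.val = 2 ^ i.val := by
    decide +kernel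
  obtain ⟨e, he⟩ := exists_affine_equiv u.1 u.2
  have hB : ∀ x, (wittBlock u x && wittBlock v x) = (wittBase (e x) &&
      wittBase (2 ^ (v.1 - u.1).val * e x + (v.2 - 2 ^ (v.1 - u.1).val * u.2))) := fun x => by
    simp only [wittBlock, he]
    congr 2
    linear_combination -x * hpow v.1 u.1
  have hsum : (∑ x, if wittBlock u x && wittBlock v x then 1 else 0 : ℕ) =
      ∑ x, if wittBase x && wittBase (2 ^ (v.1 - u.1).val * x +
        (v.2 - 2 ^ (v.1 - u.1).val * u.2)) then 1 else 0 := by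
    simp only [hB]
    exact e.sum_comp fun x => if wittBase x && wittBase (2 ^ (v.1 - u.1).val * x +
        (v.2 - 2 ^ (v.1 - u.1).val * u.2)) then (1 : ℕ) else 0
  rw [hsum]
  refine (wittBase_inter (v.1 - u.1) (v.2 - 2 ^ (v.1 - u.1).val * u.2)).resolve_left ?_
  rintro ⟨h1, h3⟩
  rw [h1] at h3
  have h4 : v.2 = u.2 := by simpa [sub_eq_zero] using h3
  exact huv (Prod.ext (sub_eq_zero.1 h1).symm h4.symm)

theorem card_wittBlock (u : Fin 11 × ZMod 23) :
    (∑ x, if wittBlock u x then 1 else 0 : ℕ) = 7 := by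
  obtain ⟨e, he⟩ := exists_affine_equiv u.1 u.2
  have : (∑ x, if wittBlock u x then 1 else 0 : ℕ) = ∑ x, if wittBase x then 1 else 0 := by
    simp only [wittBlock, ← he]
    exact e.sum_comp fun x => if wittBase x then (1 : ℕ) else 0
  rw [this]
  decide +kernel

/-- The incidence vector of a block of the Witt design. -/
noncomputable def wittVec (u : Fin 11 × ZMod 23) (i : Fin 23) : ℂ :=
  if wittBlock u (ZMod.finEquiv 23 i) then 1 else 0

theorem wittVec_eq_zero_or_one (u : Fin 11 × ZMod 23) (i : Fin 23) :
    wittVec u i = 0 ∨ wittVec u i = 1 := by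
  unfold wittVec
  split_ifs <;> simp

theorem one_dotProduct_wittVec (u : Fin 11 × ZMod 23) : 1 ⬝ᵥ wittVec u = 7 := by
  have h : ((∑ x, if wittBlock u x then 1 else 0 : ℕ) : ℂ) = 7 := by rw [card_wittBlock]; norm_num
  push_cast at h
  rw [one_dotProduct, ← h]
  exact (ZMod.finEquiv 23).toEquiv.sum_comp fun x => if wittBlock u x then (1 : ℂ) else 0

theorem wittVec_dotProduct_self (u : Fin 11 × ZMod 23) : wittVec u ⬝ᵥ wittVec u = 7 := by
  rw [← one_dotProduct_wittVec u, one_dotProduct]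
  refine Finset.sum_congr rfl fun i _ => ?_
  rcases wittVec_eq_zero_or_one u i with h | h <;> simp [h]

theorem wittVec_dotProduct (u v : Fin 11 × ZMod 23) (huv : u ≠ v) :
    wittVec u ⬝ᵥ wittVec v = 1 ∨ wittVec u ⬝ᵥ wittVec v = 3 := by
  have h : wittVec u ⬝ᵥ wittVec v =
      ((∑ x, if wittBlock u x && wittBlock v x then 1 else 0 : ℕ) : ℂ) := by
    push_cast
    rw [← (ZMod.finEquiv 23).toEquiv.sum_comp]
    refine Finset.sum_congr rfl fun x _ => ?_
    simp only [wittVec, RingEquiv.toEquiv_eq_coe, RingEquiv.coe_toEquiv]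
    cases wittBlock u (ZMod.finEquiv 23 x) <;> cases wittBlock v (ZMod.finEquiv 23 x) <;> simp
  rw [h]
  rcases card_wittBlock_inter u v huv with h | h <;> rw [h] <;> norm_num

theorem exists_decomposition_twenty_three :
    ∃ a : Fin ((23 + 1).choose 2) → Fin 23 → ℂ, qpoly 23 ^ 2 = ∑ k, linForm (a k) ^ 4 := by
  obtain ⟨r, hr⟩ := IsAlgClosed.exists_pow_nat_eq (3 : ℂ) (n := 2) (by norm_num)
  obtain ⟨w, hw⟩ := IsAlgClosed.exists_pow_nat_eq (5 : ℂ)⁻¹ (n := 2) (by norm_num)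
  let b : Fin 23 ⊕ Fin 11 × ZMod 23 → Fin 23 → ℂ := Sum.elim
    (fun i => w • ((2 : ℂ) • Pi.single i 1 + ((-2 + 3 * r) / 23) • 1))
    fun u => w • (wittVec u + ((-7 - r) / 23) • 1)
  have hone : (1 : Fin 23 → ℂ) ⬝ᵥ 1 = 23 := by simp [one_dotProduct]
  have hss : ∀ i j, b (.inl i) ⬝ᵥ b (.inl j) = if i = j then 1 else 1 / 5 := fun i j => by
    simp only [b, Sum.elim_inl, add_dotProduct, dotProduct_add, smul_dotProduct, dotProduct_smul,
      single_one_dotProduct, dotProduct_single_one, hone, smul_eq_mul, Pi.one_apply,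
      Pi.smul_apply, Pi.add_apply, Pi.single_apply, eq_comm (a := j)]
    split_ifs
    · linear_combination 5 * hw + 9 / 23 * w ^ 2 * hr
    · linear_combination hw + 9 / 23 * w ^ 2 * hr
  have hsb : ∀ i u, (b (.inl i) ⬝ᵥ b (.inr u)) ^ 2 = 1 / 25 := fun i u => by
    have : b (.inl i) ⬝ᵥ b (.inr u) = w ^ 2 * (2 * wittVec u i - 1) := by
      simp only [b, Sum.elim_inl, Sum.elim_inr, add_dotProduct, dotProduct_add, smul_dotProduct,
        dotProduct_smul, single_one_dotProduct, hone, one_dotProduct_wittVec, smul_eq_mul,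
        Pi.one_apply]
      linear_combination (-3 / 23 * w ^ 2) * hr
    rw [this, hw]
    rcases wittVec_eq_zero_or_one u i with h | h <;> rw [h] <;> norm_num
  have hbb : ∀ u v, b (.inr u) ⬝ᵥ b (.inr v) = w ^ 2 * (wittVec u ⬝ᵥ wittVec v - 2) := fun u v => by
    simp only [b, Sum.elim_inr, add_dotProduct, dotProduct_add, smul_dotProduct,
      dotProduct_smul, hone, one_dotProduct_wittVec, dotProduct_comm _ (1 : Fin 23 → ℂ), smul_eq_mul]
    linear_combination (1 / 23 * w ^ 2) * hr
  have hb1 : ∀ j, b j ⬝ᵥ b j = 1 := by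
    rintro (i | u)
    · rw [hss, if_pos rfl]
    · rw [hbb, wittVec_dotProduct_self, hw]
      norm_num
  have hb : ∀ j k, (b j ⬝ᵥ b k) ^ 2 = (1 - 1 / 25) * (if j = k then 1 else 0) + 1 / 25 := by
    intro j k
    by_cases hjk : j = k
    · subst hjk
      rw [hb1, if_pos rfl]
      norm_num
    rw [if_neg hjk, mul_zero, zero_add]
    rcases j with i | u <;> rcases k with j | v
    · rw [hss, if_neg fun h => hjk (congrArg _ h)]
      norm_num
    · exact hsb i v
    · rw [dotProduct_comm]
      exact hsb j u
    · rw [hbb, hw]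
      rcases wittVec_dotProduct u v fun h => hjk (congrArg _ h) with h | h <;> rw [h] <;> norm_num
  have hcard : Fintype.card (Fin 23 ⊕ Fin 11 × ZMod 23) = (23 + 1).choose 2 := by
    simp [ZMod.card, Nat.choose]
  have hcard' : (Fintype.card (Fin 23 ⊕ Fin 11 × ZMod 23) : ℂ) = 276 := by
    rw [hcard]
    norm_num [Nat.choose]
  refine exists_decomposition hcard b ?_
    (sum_pow_four_of_equiangular hcard b (by norm_num) ?_ hb hb1) <;>
  · rw [hcard']
    norm_num

theorem choose_lt_of_decomposition {n r : ℕ} (hn : 3 < n)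
    (hm : ¬∃ m : ℕ, Odd m ∧ n = m ^ 2 - 2) {a : Fin r → Fin n → ℂ}
    (h : qpoly n ^ 2 = ∑ k, linForm (a k) ^ 4) : (n + 1).choose 2 < r := by
  refine (choose_le_of_decomposition h).lt_of_ne ?_
  rintro rfl
  exact hm (exists_odd_sq_of_decomposition hn h)

/-- The Waring rank of q_n^2 for n ≥ 3, with T_{n,2} = binom(n+1,2):
(1) n ∈ {3,7,23}: rank = T_{n,2}; (2) n > 23 and n = m²−2 with m odd:
T_{n,2} ≤ rank ≤ T_{n,2}+1; (3) n = 8: T_{8,2}+1 ≤ rank ≤ T_{8,2}+9;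
(4) otherwise, rank = T_{n,2}+1. -/
theorem waringRank_square_of_quadric (n : ℕ) (hn : 3 ≤ n) :
    ((n = 3 ∨ n = 7 ∨ n = 23) →
      waringRank n 4 (qpoly n ^ 2) = (n + 1).choose 2) ∧
    ((23 < n ∧ ∃ m : ℕ, Odd m ∧ n = m ^ 2 - 2) →
      (n + 1).choose 2 ≤ waringRank n 4 (qpoly n ^ 2) ∧
        waringRank n 4 (qpoly n ^ 2) ≤ (n + 1).choose 2 + 1) ∧
    (n = 8 →
      (n + 1).choose 2 + 1 ≤ waringRank n 4 (qpoly n ^ 2) ∧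
        waringRank n 4 (qpoly n ^ 2) ≤ (n + 1).choose 2 + 9) ∧
    (¬(n = 3 ∨ n = 7 ∨ n = 23) → ¬(23 < n ∧ ∃ m : ℕ, Odd m ∧ n = m ^ 2 - 2) → n ≠ 8 →
      waringRank n 4 (qpoly n ^ 2) = (n + 1).choose 2 + 1) := by
  have lower : ∀ t, ∀ a : Fin t → Fin n → ℂ, qpoly n ^ 2 = ∑ k, linForm (a k) ^ 4 →
      (n + 1).choose 2 ≤ t := fun t a h => choose_le_of_decomposition h
  refine ⟨?_, ?_, ?_, ?_⟩
  · rintro (rfl | rfl | rfl)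
    · exact le_antisymm (waringRank_le_of_decomposition exists_decomposition_three)
        (le_waringRank exists_decomposition_three lower)
    · exact le_antisymm (waringRank_le_of_decomposition exists_decomposition_seven)
        (le_waringRank exists_decomposition_seven lower)
    · exact le_antisymm (waringRank_le_of_decomposition exists_decomposition_twenty_three)
        (le_waringRank exists_decomposition_twenty_three lower)
  · rintro ⟨hn23, -⟩
    have h := exists_decomposition_succ (n := n) (by omega) (by omega)
    exact ⟨le_waringRank h lower, waringRank_le_of_decomposition h⟩
  · rintro rfl
    refine ⟨le_waringRank exists_decomposition_eight fun t a h => ?_,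
      waringRank_le_of_decomposition exists_decomposition_eight⟩
    refine choose_lt_of_decomposition (by norm_num) ?_ h
    rintro ⟨m, -, hm⟩
    have : m ≤ 3 := by
      by_contra! hm3
      have : 4 ^ 2 ≤ m ^ 2 := Nat.pow_le_pow_left hm3 2
      omega
    interval_cases m <;> omega
  · intro h3 h23 h8
    have hdec := exists_decomposition_succ (n := n) (by omega) h8
    refine le_antisymm (waringRank_le_of_decomposition hdec)
      (le_waringRank hdec fun t a h => choose_lt_of_decomposition (by omega) ?_ h)
    rintro ⟨m, hm, hnm⟩
    refine h23 ⟨?_, m, hm, hnm⟩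
    by_contra! hle
    have : m ≤ 5 := by
      by_contra! hm5
      have : 6 ^ 2 ≤ m ^ 2 := Nat.pow_le_pow_left hm5 2
      omega
    obtain ⟨k, rfl⟩ := hm
    have : k ≤ 2 := by omega
    interval_cases k <;> omega
end

section
/- The Waring rank of the fourth power of the ternary quadratic form q_3 = X_1^2+X_2^2+X_3^2 equals 16: rk(q_3^4) = 16 (one more than the middle catalecticant bound T_{3,4} = binom(6,4) = 15). -/
open MvPolynomial

/-! ### Coefficients of powers of linear forms and moments -/

lemma coeff_linForm_pow {n : ℕ} (a : Fin n → ℂ) (d : Fin n →₀ ℕ) :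
    coeff d (linForm a ^ (∑ i, d i)) =
      (Nat.multinomial Finset.univ d : ℂ) * ∏ i, a i ^ d i := by
  classical
  have hterm (k : Fin n → ℕ) :
      ((Nat.multinomial Finset.univ k : ℕ) : MvPolynomial (Fin n) ℂ) * ∏ i, (C (a i) * X i) ^ k i =
        monomial (Finsupp.equivFunOnFinite.symm k)
          ((Nat.multinomial Finset.univ k : ℂ) * ∏ i, a i ^ k i) := by
    rw [monomial_eq, Finsupp.prod_fintype _ _ (by simp)]
    simp [mul_pow, Finset.prod_mul_distrib, mul_assoc]
  rw [linForm, Finset.sum_pow_eq_sum_piAntidiag, coeff_sum]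
  simp_rw [hterm, coeff_monomial]
  rw [Finset.sum_eq_single (d : Fin n → ℕ)]
  · simp
  · intro k _ hk
    rw [if_neg]
    rintro rfl
    exact hk (by simp)
  · simp

lemma qpoly_eq_expand (n : ℕ) : qpoly n = expand 2 (linForm fun _ => 1) := by
  simp [qpoly, linForm]

/-- The moment of the standard Gaussian distribution with exponents `d`. -/
def gaussianMoment (d : Fin 3 → ℕ) : ℤ :=
  ∏ i, if Even (d i) then ((d i - 1).doubleFactorial : ℤ) else 0

lemma gaussianMoment_mul_multinomial (p q r : ℕ) (h : p + q + r = 4) :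
    gaussianMoment ![2 * p, 2 * q, 2 * r] *
      (Nat.multinomial Finset.univ ![2 * p, 2 * q, 2 * r] : ℤ) =
      105 * (Nat.multinomial Finset.univ ![p, q, r] : ℤ) := by
  have hp : p ≤ 4 := by omega
  have hq : q ≤ 4 := by omega
  have hr : r ≤ 4 := by omega
  interval_cases p <;> interval_cases q <;> interval_cases r <;> revert h <;> decide +kernel

lemma moment_eq_gaussianMoment {ι : Type*} [Fintype ι] {a : ι → Fin 3 → ℂ}
    (h : qpoly 3 ^ 4 = ∑ k, linForm (a k) ^ 8) (d : Fin 3 → ℕ) (hd : ∑ i, d i = 8) :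
    105 * ∑ k, ∏ i, a k i ^ d i = (gaussianMoment d : ℂ) := by
  have hmult : (Nat.multinomial Finset.univ d : ℂ) ≠ 0 := by
    exact_mod_cast (Nat.multinomial_pos _ _).ne'
  have hcoeff : coeff (Finsupp.equivFunOnFinite.symm d) (qpoly 3 ^ 4) =
      (Nat.multinomial Finset.univ d : ℂ) * ∑ k, ∏ i, a k i ^ d i := by
    rw [h, coeff_sum, Finset.mul_sum]
    refine Finset.sum_congr rfl fun k _ => ?_
    have := coeff_linForm_pow (a k) (Finsupp.equivFunOnFinite.symm d)
    simpa [hd] using this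
  apply mul_left_cancel₀ hmult
  rw [mul_left_comm, ← hcoeff, qpoly_eq_expand, ← map_pow]
  by_cases heven : ∀ i, 2 ∣ d i
  · choose e he using heven
    obtain rfl : d = fun i => 2 * e i := funext he
    rw [← Finset.mul_sum] at hd
    have hsum : ∑ i, e i = 4 := by omega
    have hsmul : Finsupp.equivFunOnFinite.symm (fun i => 2 * e i) =
        2 • Finsupp.equivFunOnFinite.symm e := by ext; simp
    have hlin := coeff_linForm_pow (fun _ => 1) (Finsupp.equivFunOnFinite.symm e)
    simp only [Finsupp.equivFunOnFinite_symm_apply_apply, hsum, one_pow, Finset.prod_const_one,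
      mul_one] at hlin
    rw [hsmul, coeff_expand_smul _ two_ne_zero, hlin]
    have key := gaussianMoment_mul_multinomial (e 0) (e 1) (e 2)
      (by rw [← hsum, Fin.sum_univ_three])
    have he' : (![e 0, e 1, e 2] : Fin 3 → ℕ) = e := by ext i; fin_cases i <;> rfl
    have he2 : (![2 * e 0, 2 * e 1, 2 * e 2] : Fin 3 → ℕ) = fun i => 2 * e i := by
      ext i; fin_cases i <;> rfl
    rw [he', he2, mul_comm] at key
    exact_mod_cast key.symm
  · push Not at heven
    obtain ⟨i, hi⟩ := heven
    rw [coeff_expand_of_not_dvd _ (i := i) (by simpa using hi), gaussianMoment,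
      Finset.prod_eq_zero (Finset.mem_univ i) (if_neg (by rwa [even_iff_two_dvd]))]
    simp

/-! ### The reproducing kernel on ternary quartics -/

/-- The exponents of the monomials of degree four in three variables. -/
def quarticExponent : Fin 15 → Fin 3 → ℕ :=
  ![![4, 0, 0], ![0, 4, 0], ![0, 0, 4], ![2, 2, 0], ![2, 0, 2], ![0, 2, 2],
    ![3, 1, 0], ![1, 3, 0], ![1, 1, 2], ![3, 0, 1], ![1, 0, 3], ![1, 2, 1],
    ![0, 3, 1], ![0, 1, 3], ![2, 1, 1]]

/-- The Gram matrix of the quartic monomials for the Gaussian inner product. -/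
def quarticGram : Matrix (Fin 15) (Fin 15) ℤ :=
  Matrix.of fun k l => gaussianMoment (quarticExponent k + quarticExponent l)

/-- The matrix of `21 s ^ 4 - 14 s ^ 2 p q + p ^ 2 q ^ 2` in the quartic monomials, where
`s = x ⬝ y`, `p = x ⬝ x` and `q = y ⬝ y`. -/
def quarticKernel : Matrix (Fin 15) (Fin 15) ℤ :=
  !![8, 1, 1, -12, -12, 2, 0, 0, 0, 0, 0, 0, 0, 0, 0;
    1, 8, 1, -12, 2, -12, 0, 0, 0, 0, 0, 0, 0, 0, 0;
    1, 1, 8, 2, -12, -12, 0, 0, 0, 0, 0, 0, 0, 0, 0;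
    -12, -12, 2, 102, -10, -10, 0, 0, 0, 0, 0, 0, 0, 0, 0;
    -12, 2, -12, -10, 102, -10, 0, 0, 0, 0, 0, 0, 0, 0, 0;
    2, -12, -12, -10, -10, 102, 0, 0, 0, 0, 0, 0, 0, 0, 0;
    0, 0, 0, 0, 0, 0, 56, -28, -28, 0, 0, 0, 0, 0, 0;
    0, 0, 0, 0, 0, 0, -28, 56, -28, 0, 0, 0, 0, 0, 0;
    0, 0, 0, 0, 0, 0, -28, -28, 224, 0, 0, 0, 0, 0, 0;
    0, 0, 0, 0, 0, 0, 0, 0, 0, 56, -28, -28, 0, 0, 0;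
    0, 0, 0, 0, 0, 0, 0, 0, 0, -28, 56, -28, 0, 0, 0;
    0, 0, 0, 0, 0, 0, 0, 0, 0, -28, -28, 224, 0, 0, 0;
    0, 0, 0, 0, 0, 0, 0, 0, 0, 0, 0, 0, 56, -28, -28;
    0, 0, 0, 0, 0, 0, 0, 0, 0, 0, 0, 0, -28, 56, -28;
    0, 0, 0, 0, 0, 0, 0, 0, 0, 0, 0, 0, -28, -28, 224]

lemma quarticGram_mul_quarticKernel : quarticGram * quarticKernel = 504 := by
  decide +kernel

/-- The values at `x` of the quartic monomials. -/
def quarticMonomials (x : Fin 3 → ℂ) (k : Fin 15) : ℂ :=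
  ∏ i, x i ^ quarticExponent k i

lemma dotProduct_quarticKernel_mulVec (x y : Fin 3 → ℂ) :
    quarticMonomials x ⬝ᵥ (quarticKernel.map (Int.cast : ℤ → ℂ)).mulVec (quarticMonomials y) =
      21 * dotC x y ^ 4 - 14 * dotC x y ^ 2 * (dotC x x * dotC y y) +
        (dotC x x * dotC y y) ^ 2 := by
  simp [dotProduct, Matrix.mulVec, quarticMonomials, quarticKernel, quarticExponent, dotC,
    Fin.sum_univ_succ, Fin.prod_univ_succ]
  ring

lemma kernel_eq_ite {a : Fin 15 → Fin 3 → ℂ} (h : qpoly 3 ^ 4 = ∑ k, linForm (a k) ^ 8)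
    (i j : Fin 15) :
    21 * dotC (a i) (a j) ^ 4 - 14 * dotC (a i) (a j) ^ 2 * (dotC (a i) (a i) * dotC (a j) (a j)) +
        (dotC (a i) (a i) * dotC (a j) (a j)) ^ 2 = if i = j then 24 / 5 else 0 := by
  set E : Matrix (Fin 15) (Fin 15) ℂ := Matrix.of fun i k => quarticMonomials (a i) k with hE
  set K : Matrix (Fin 15) (Fin 15) ℂ := quarticKernel.map (Int.cast : ℤ → ℂ) with hK
  have hgram : (105 : ℂ) • (E.transpose * E) = quarticGram.map (Int.cast : ℤ → ℂ) := by
    ext k l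
    have hdeg : ∑ i, (quarticExponent k + quarticExponent l) i = 8 := by
      revert k l; decide +kernel
    simp [Matrix.mul_apply, hE, quarticGram, ← moment_eq_gaussianMoment h _ hdeg,
      quarticMonomials, pow_add, Finset.prod_mul_distrib]
  have hinv : E.transpose * ((5 / 24 : ℂ) • (E * K)) = 1 := by
    have hmul := congrArg (fun M : Matrix (Fin 15) (Fin 15) ℤ => M.map (Int.castRingHom ℂ))
      quarticGram_mul_quarticKernel
    simp only [Matrix.map_mul] at hmul
    have h504 : (504 : Matrix (Fin 15) (Fin 15) ℤ).map (Int.castRingHom ℂ) =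
        (504 : ℂ) • (1 : Matrix (Fin 15) (Fin 15) ℂ) := by
      ext i j
      by_cases hij : i = j <;> simp [hij, Matrix.ofNat_apply]
    rw [h504] at hmul
    change quarticGram.map (Int.cast : ℤ → ℂ) * K = _ at hmul
    rw [← hgram, Matrix.smul_mul] at hmul
    rw [Matrix.mul_smul, ← Matrix.mul_assoc]
    have := congrArg (fun M => (1 / 504 : ℂ) • M) hmul
    simp only [smul_smul] at this
    norm_num at this
    exact this
  have hinv' := congrFun (congrFun (mul_eq_one_comm.mp hinv :) i) j
  rw [← dotProduct_quarticKernel_mulVec, ← hK]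
  have hentry : (E * K * E.transpose) i j =
      quarticMonomials (a i) ⬝ᵥ K.mulVec (quarticMonomials (a j)) := by
    rw [Matrix.mul_assoc]
    rfl
  rw [← hentry]
  simp only [Matrix.smul_mul, Matrix.smul_apply, Matrix.one_apply, smul_eq_mul] at hinv'
  split_ifs at hinv' ⊢ <;> linear_combination (24 / 5) * hinv'

lemma gaussianMoment_mul_normSq_pow_three (p q r : ℕ) (h : p + q + r = 2) :
    gaussianMoment ![p, q, r + 6] +
        3 * gaussianMoment ![p, q + 2, r + 4] +
        3 * gaussianMoment ![p, q + 4, r + 2] +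
        gaussianMoment ![p, q + 6, r] +
        3 * gaussianMoment ![p + 2, q, r + 4] +
        6 * gaussianMoment ![p + 2, q + 2, r + 2] +
        3 * gaussianMoment ![p + 2, q + 4, r] +
        3 * gaussianMoment ![p + 4, q, r + 2] +
        3 * gaussianMoment ![p + 4, q + 2, r] +
        gaussianMoment ![p + 6, q, r] =
      315 * gaussianMoment ![p, q, r] := by
  have hp : p ≤ 2 := by omega
  have hq : q ≤ 2 := by omega
  have hr : r ≤ 2 := by omega
  interval_cases p <;> interval_cases q <;> interval_cases r <;> revert h <;> decide +kernel

lemma sum_dotC_sq_mul_dotC_self_pow {ι : Type*} [Fintype ι] {a : ι → Fin 3 → ℂ}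
    (h : qpoly 3 ^ 4 = ∑ k, linForm (a k) ^ 8) (b : Fin 3 → ℂ) :
    ∑ k, dotC (a k) b ^ 2 * dotC (a k) (a k) ^ 3 = 3 * dotC b b := by
  have hm (p q r : ℕ) (hpqr : p + q + r = 8) :
      ∑ k, a k 0 ^ p * a k 1 ^ q * a k 2 ^ r = (gaussianMoment ![p, q, r] : ℂ) / 105 := by
    have := moment_eq_gaussianMoment h ![p, q, r] (by simpa [Fin.sum_univ_three] using hpqr)
    simp only [Fin.prod_univ_three] at this
    rw [eq_div_iff (by norm_num), mul_comm]
    exact this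
  have hquad (p q r : ℕ) (hpqr : p + q + r = 2) :
      ∑ k, (a k 0 ^ p * a k 1 ^ q * a k 2 ^ r) * (a k 0 ^ 2 + a k 1 ^ 2 + a k 2 ^ 2) ^ 3 =
        3 * (gaussianMoment ![p, q, r] : ℂ) := by
    have hexpand (k : ι) :
        (a k 0 ^ p * a k 1 ^ q * a k 2 ^ r) * (a k 0 ^ 2 + a k 1 ^ 2 + a k 2 ^ 2) ^ 3 =
        a k 0 ^ p * a k 1 ^ q * a k 2 ^ (r + 6) +
        3 * (a k 0 ^ p * a k 1 ^ (q + 2) * a k 2 ^ (r + 4)) +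
        3 * (a k 0 ^ p * a k 1 ^ (q + 4) * a k 2 ^ (r + 2)) +
        a k 0 ^ p * a k 1 ^ (q + 6) * a k 2 ^ r +
        3 * (a k 0 ^ (p + 2) * a k 1 ^ q * a k 2 ^ (r + 4)) +
        6 * (a k 0 ^ (p + 2) * a k 1 ^ (q + 2) * a k 2 ^ (r + 2)) +
        3 * (a k 0 ^ (p + 2) * a k 1 ^ (q + 4) * a k 2 ^ r) +
        3 * (a k 0 ^ (p + 4) * a k 1 ^ q * a k 2 ^ (r + 2)) +
        3 * (a k 0 ^ (p + 4) * a k 1 ^ (q + 2) * a k 2 ^ r) +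
        a k 0 ^ (p + 6) * a k 1 ^ q * a k 2 ^ r := by
      ring
    have key := congrArg (Int.cast : ℤ → ℂ) (gaussianMoment_mul_normSq_pow_three p q r hpqr)
    push_cast at key
    simp_rw [hexpand, Finset.sum_add_distrib, ← Finset.mul_sum]
    rw [hm p q (r + 6) (by omega), hm p (q + 2) (r + 4) (by omega),
      hm p (q + 4) (r + 2) (by omega), hm p (q + 6) r (by omega),
      hm (p + 2) q (r + 4) (by omega), hm (p + 2) (q + 2) (r + 2) (by omega),
      hm (p + 2) (q + 4) r (by omega), hm (p + 4) q (r + 2) (by omega),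
      hm (p + 4) (q + 2) r (by omega), hm (p + 6) q r (by omega)]
    linear_combination key / 105
  have hexpand (k : ι) : dotC (a k) b ^ 2 * dotC (a k) (a k) ^ 3 =
      b 0 ^ 2 * ((a k 0 ^ 2 * a k 1 ^ 0 * a k 2 ^ 0) * (a k 0 ^ 2 + a k 1 ^ 2 + a k 2 ^ 2) ^ 3) +
      b 1 ^ 2 * ((a k 0 ^ 0 * a k 1 ^ 2 * a k 2 ^ 0) * (a k 0 ^ 2 + a k 1 ^ 2 + a k 2 ^ 2) ^ 3) +
      b 2 ^ 2 * ((a k 0 ^ 0 * a k 1 ^ 0 * a k 2 ^ 2) * (a k 0 ^ 2 + a k 1 ^ 2 + a k 2 ^ 2) ^ 3) +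
      2 * b 0 * b 1 *
        ((a k 0 ^ 1 * a k 1 ^ 1 * a k 2 ^ 0) * (a k 0 ^ 2 + a k 1 ^ 2 + a k 2 ^ 2) ^ 3) +
      2 * b 0 * b 2 *
        ((a k 0 ^ 1 * a k 1 ^ 0 * a k 2 ^ 1) * (a k 0 ^ 2 + a k 1 ^ 2 + a k 2 ^ 2) ^ 3) +
      2 * b 1 * b 2 *
        ((a k 0 ^ 0 * a k 1 ^ 1 * a k 2 ^ 1) * (a k 0 ^ 2 + a k 1 ^ 2 + a k 2 ^ 2) ^ 3) := by
    simp only [dotC, Fin.sum_univ_three]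
    ring
  have hdiag : gaussianMoment ![2, 0, 0] = 1 ∧ gaussianMoment ![0, 2, 0] = 1 ∧
      gaussianMoment ![0, 0, 2] = 1 := by
    decide +kernel
  have hoff : gaussianMoment ![1, 1, 0] = 0 ∧ gaussianMoment ![1, 0, 1] = 0 ∧
      gaussianMoment ![0, 1, 1] = 0 := by
    decide +kernel
  simp_rw [hexpand, Finset.sum_add_distrib, ← Finset.mul_sum]
  rw [hquad 2 0 0 rfl, hquad 0 2 0 rfl, hquad 0 0 2 rfl, hquad 1 1 0 rfl, hquad 1 0 1 rfl,
    hquad 0 1 1 rfl]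
  simp only [hdiag, hoff, dotC, Fin.sum_univ_three]
  push_cast
  ring

/-! ### Fifteen summands do not suffice -/

lemma qpoly_pow_four_ne_sum_of_eq_fifteen {r : ℕ} (hr : r = 15) (a : Fin r → Fin 3 → ℂ) :
    qpoly 3 ^ 4 ≠ ∑ k, linForm (a k) ^ 8 := by
  subst hr
  intro h
  have hnorm (i : Fin 15) : dotC (a i) (a i) ^ 4 = 3 / 5 := by
    have := kernel_eq_ite h i i
    rw [if_pos rfl] at this
    linear_combination this / 8
  have hne (i : Fin 15) : dotC (a i) (a i) ≠ 0 := by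
    intro h0
    have := hnorm i
    norm_num [h0] at this
  obtain ⟨s, hs⟩ := IsAlgClosed.exists_pow_nat_eq (28 : ℂ) two_pos
  let w (j : Fin 15) : ℂ :=
    21 * (dotC (a j) (a 0) ^ 2 / (dotC (a j) (a j) * dotC (a 0) (a 0))) - 7
  have hw0 : w 0 = 14 := by
    have := hne 0
    simp only [w]
    field_simp
    norm_num
  have hwsq (j : Fin 15) (hj : j ≠ 0) : w j ^ 2 = s ^ 2 := by
    have hker := kernel_eq_ite h j 0
    rw [if_neg hj] at hker
    have hj := hne j
    have h0 := hne 0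
    simp only [w, hs]
    field_simp
    linear_combination 21 * hker
  have hwsum : ∑ j, w j = 0 := by
    have hmom := sum_dotC_sq_mul_dotC_self_pow h (a 0)
    have hterm (j : Fin 15) : dotC (a j) (a 0) ^ 2 * dotC (a j) (a j) ^ 3 =
        3 / 5 * dotC (a 0) (a 0) * ((w j + 7) / 21) := by
      have hj := hne j
      have h0 := hne 0
      rw [← hnorm j]
      simp only [w]
      field_simp
      ring
    simp_rw [hterm] at hmom
    rw [← Finset.mul_sum, ← Finset.sum_div, Finset.sum_add_distrib] at hmom
    simp only [Finset.sum_const, Finset.card_univ, Fintype.card_fin, nsmul_eq_mul] at hmom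
    apply mul_left_cancel₀ (hne 0)
    push_cast at hmom
    linear_combination 35 * hmom
  have hsign (j : Fin 15) : ∃ ε : ℤ, j ≠ 0 → w j = ε * s := by
    by_cases hj : j = 0
    · exact ⟨0, fun h => absurd hj h⟩
    · rcases sq_eq_sq_iff_eq_or_eq_neg.mp (hwsq j hj) with h | h
      · exact ⟨1, fun _ => by simpa using h⟩
      · exact ⟨-1, fun _ => by simpa using h⟩
  choose ε hε using hsign
  rw [Fin.sum_univ_succ, hw0] at hwsum
  simp_rw [fun j : Fin 14 => hε j.succ (Fin.succ_ne_zero j), ← Finset.sum_mul, ← Int.cast_sum]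
    at hwsum
  set n : ℤ := ∑ j : Fin 14, ε j.succ
  have hn : n ^ 2 = 7 := by
    have : (n : ℂ) ^ 2 = 7 := by
      linear_combination (n * s - 14) / 28 * hwsum - (n : ℂ) ^ 2 / 28 * hs
    exact_mod_cast this
  have h1 : n < 3 := by nlinarith
  have h2 : -3 < n := by nlinarith
  interval_cases n <;> omega

lemma sum_append_zero_linForm_pow {n d r m : ℕ} (hd : d ≠ 0) (a : Fin r → Fin n → ℂ) :
    ∑ k, linForm (Fin.append a (0 : Fin m → Fin n → ℂ) k) ^ d = ∑ k, linForm (a k) ^ d := by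
  simp [Fin.sum_univ_add, linForm, hd]

/-! ### Sixteen summands suffice -/

/-- Representatives of the axes through the vertices of a regular icosahedron and of its dual
dodecahedron, where `φ` is the golden ratio, with the two orbits scaled by `α` and `β`. -/
def icosaDodecaAxes (φ α β : ℂ) : Fin 16 → Fin 3 → ℂ :=
  ![α • ![0, 1, φ], α • ![0, 1, -φ], α • ![φ, 0, 1], α • ![-φ, 0, 1],
    α • ![1, φ, 0], α • ![1, -φ, 0],
    β • ![1, 1, 1], β • ![1, 1, -1], β • ![1, -1, 1], β • ![-1, 1, 1],
    β • ![0, φ, φ - 1], β • ![0, -φ, φ - 1], β • ![φ - 1, 0, φ], β • ![φ - 1, 0, -φ],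
    β • ![φ, φ - 1, 0], β • ![-φ, φ - 1, 0]]

lemma qpoly_pow_four_eq_sum_sixteen :
    ∃ a : Fin 16 → Fin 3 → ℂ, qpoly 3 ^ 4 = ∑ k, linForm (a k) ^ 8 := by
  obtain ⟨s, hs⟩ := IsAlgClosed.exists_pow_nat_eq (5 : ℂ) two_pos
  obtain ⟨φ, hφ⟩ : ∃ φ : ℂ, φ ^ 2 = φ + 1 := ⟨(1 + s) / 2, by linear_combination hs / 4⟩
  obtain ⟨α, hα⟩ := IsAlgClosed.exists_pow_nat_eq (3 * (5 - 3 * φ) / 140) (n := 8) (by norm_num)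
  obtain ⟨β, hβ⟩ := IsAlgClosed.exists_pow_nat_eq (1 / 140 : ℂ) (n := 8) (by norm_num)
  refine ⟨icosaDodecaAxes φ α β, MvPolynomial.funext fun x => ?_⟩
  let ico (y z : ℂ) : ℂ := (y + φ * z) ^ 8 + (y - φ * z) ^ 8
  let dod (y z : ℂ) : ℂ := ((φ - 1) * y + φ * z) ^ 8 + ((φ - 1) * y - φ * z) ^ 8
  let cube : ℂ := (x 0 + x 1 + x 2) ^ 8 + (x 0 + x 1 - x 2) ^ 8 + (x 0 - x 1 + x 2) ^ 8 +
    (-x 0 + x 1 + x 2) ^ 8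
  have hico (y z : ℂ) : (5 - 3 * φ) * ico y z =
      2 * ((5 - 3 * φ) * y ^ 8 + 28 * (2 - φ) * y ^ 6 * z ^ 2 + 70 * y ^ 4 * z ^ 4 +
        28 * (φ + 1) * y ^ 2 * z ^ 6 + (3 * φ + 2) * z ^ 8) := by
    grind
  have hdod (y z : ℂ) : dod y z =
      2 * ((34 - 21 * φ) * y ^ 8 + 28 * (5 - 3 * φ) * y ^ 6 * z ^ 2 + 70 * y ^ 4 * z ^ 4 +
        28 * (3 * φ + 2) * y ^ 2 * z ^ 6 + (21 * φ + 13) * z ^ 8) := by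
    grind
  have hsum : eval x (∑ k, linForm (icosaDodecaAxes φ α β k) ^ 8) =
      α ^ 8 * (ico (x 1) (x 2) + ico (x 2) (x 0) + ico (x 0) (x 1)) +
        β ^ 8 * (cube + (dod (x 2) (x 1) + dod (x 0) (x 2) + dod (x 1) (x 0))) := by
    simp [linForm, icosaDodecaAxes, Fin.sum_univ_succ, ico, dod, cube]
    ring
  rw [hsum, hα, hβ]
  simp only [qpoly, Fin.sum_univ_three, map_add, map_pow, eval_X]
  linear_combination -(3 / 140) * (hico (x 1) (x 2) + hico (x 2) (x 0) + hico (x 0) (x 1)) -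
    (1 / 140) * (hdod (x 2) (x 1) + hdod (x 0) (x 2) + hdod (x 1) (x 0))

/-- The Waring rank of q_3^4 equals 16. -/
theorem waringRank_fourth_power_ternary_quadric :
    waringRank 3 8 (qpoly 3 ^ 4) = 16 := by
  apply le_antisymm
  · exact Nat.sInf_le qpoly_pow_four_eq_sum_sixteen
  · refine le_csInf ⟨16, qpoly_pow_four_eq_sum_sixteen⟩ ?_
    rintro r ⟨a, ha⟩
    by_contra! hr
    obtain ⟨m, hm⟩ := Nat.exists_eq_add_of_le (Nat.le_of_lt_succ hr)
    rw [← sum_append_zero_linForm_pow (m := m) (by norm_num) a] at ha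
    exact qpoly_pow_four_ne_sum_of_eq_fifteen hm.symm _ ha
end
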